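/- For every n ≥ 0, the polynomial identities c_{2n+1}(t) = Σ_{k=0}^{n} (-t)^k·binom(n,k)·C_k·(1+t)^{2n-2k} and c_{2n+2}(t) = Σ_{k=0}^{n} (-t)^k·binom(n,k)·C_k·(1+t)^{2n-2k+1} hold in ℤ[t], where C_k is the k-th Catalan number. -/

import Mathlib

open Polynomial Finset

/-- The Jacobi-type array: `a 0 k = [k = 0]`, and
`a (n+1) k = a n (k-1) + s k * a n k + t k * a n (k+1)` with `a n (-1) = 0`. -/
def jacobiA {R : Type*} [CommRing R] (s t : ℕ → R) : ℕ → ℕ → R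
  | 0, k => if k = 0 then 1 else 0
  | n+1, k =>
      (if k = 0 then 0 else jacobiA s t n (k-1)) + s k * jacobiA s t n k
        + t k * jacobiA s t n (k+1)

/-- The Narayana polynomial `C_n(t) ∈ ℤ[t]`:
`C_0(t) = 1` and `C_n(t) = ∑_{k=0}^{n-1} (1/(k+1))·binom(n,k)·binom(n-1,k)·t^k` for `n ≥ 1`. -/
noncomputable def narayana (n : ℕ) : Polynomial ℤ :=
  if n = 0 then 1 else
    ∑ k ∈ Finset.range n,
      Polynomial.C ((n.choose k * (n-1).choose k / (k+1) : ℕ) : ℤ) * Polynomial.X ^ k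

/-- The polynomial `c_n(t) = C_n(t;-1) ∈ ℤ[t]`: `c_0(t) = 1` and
`c_n(t) = ∑_{k=0}^{n} binom(⌊(n-1)/2⌋,⌊k/2⌋)·binom(⌊n/2⌋,⌊(k+1)/2⌋)·t^k` for `n ≥ 1`. -/
noncomputable def cnar (n : ℕ) : Polynomial ℤ :=
  if n = 0 then 1 else
    ∑ k ∈ Finset.range (n+1),
      Polynomial.C ((((n-1)/2).choose (k/2) * (n/2).choose ((k+1)/2) : ℕ) : ℤ) * Polynomial.X ^ k

theorem Finset.sum_range_two_mul {M : Type*} [AddCommMonoid M] (f : ℕ → M) (n : ℕ) :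
    ∑ k ∈ Finset.range (2 * n), f k = ∑ k ∈ Finset.range n, (f (2 * k) + f (2 * k + 1)) := by
  induction n with
  | zero => simp
  | succ n ih =>
    rw [show 2 * (n + 1) = 2 * n + 1 + 1 by ring, Finset.sum_range_succ, Finset.sum_range_succ,
      Finset.sum_range_succ, ih, add_assoc]

theorem coeff_X_add_C_pow_mul_one_add_X {R : Type*} [CommRing R] (t : R) {n i : ℕ} (hi : i ≤ n) :
    (((X + C t) ^ n * (1 + X) : R[X])).coeff (n - i) =
      n.choose i * t ^ i + n.choose (i + 1) * t ^ (i + 1) := by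
  rw [mul_add, mul_one, coeff_add, coeff_X_add_C_pow, Nat.sub_sub_self hi, Nat.choose_symm hi]
  rcases hi.eq_or_lt with rfl | hlt
  · simp [mul_comm]
  · obtain ⟨d, rfl⟩ := Nat.exists_eq_add_of_lt hlt
    rw [show i + d + 1 - i = d + 1 by omega, coeff_mul_X, coeff_X_add_C_pow,
      show i + d + 1 - d = i + 1 by omega,
      Nat.choose_symm_of_eq_add (show i + d + 1 = d + (i + 1) by ring)]
    ring

theorem catalan_add_choose_pred (k : ℕ) :
    catalan (k + 1) + (2 * (k + 1)).choose k = (2 * (k + 1)).choose (k + 1) := by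
  have h₁ := succ_mul_catalan_eq_centralBinom (k + 1)
  have h₂ := Nat.choose_succ_right_eq (2 * (k + 1)) k
  rw [Nat.centralBinom_eq_two_mul_choose] at h₁
  rw [show 2 * (k + 1) - k = k + 2 by omega] at h₂
  have h₃ : (k + 2) * (catalan (k + 1) + (2 * (k + 1)).choose k)
      = (k + 2) * (2 * (k + 1)).choose (k + 1) := by
    linarith
  exact Nat.eq_of_mul_eq_mul_left (by omega) h₃

theorem coeff_one_sub_X_pow_mul_one_add_X {R : Type*} [CommRing R] (k : ℕ) :
    (((1 - X) ^ (2 * k) * (1 + X) : R[X])).coeff k = (-1) ^ k * catalan k := by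
  have h : ((1 - X) ^ (2 * k) : R[X]) = (X + C (-1)) ^ (2 * k) := by
    rw [pow_mul, pow_mul]
    congr 1
    simp only [C_neg, C_1]
    ring
  rw [h, mul_add, mul_one, coeff_add, coeff_X_add_C_pow]
  cases k with
  | zero => simp
  | succ k =>
    rw [coeff_mul_X, coeff_X_add_C_pow, show 2 * (k + 1) - (k + 1) = k + 1 by omega,
      show 2 * (k + 1) - k = k + 1 + 1 by omega, ← catalan_add_choose_pred k]
    push_cast
    ring

/-- The coefficient of `Y ^ n` in `(1 + t Y) ^ n (Y + t) ^ n (1 + Y)`, computed by expanding the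
first factor and by expanding `(1 + t Y) (Y + t) = t (1 - Y) ^ 2 + (1 + t) ^ 2 Y`. -/
theorem sum_choose_mul_eq_sum_choose_mul_catalan {R : Type*} [CommRing R] (t : R) (n : ℕ) :
    ∑ i ∈ Finset.range (n + 1),
        (n.choose i : R) * t ^ i * (n.choose i * t ^ i + n.choose (i + 1) * t ^ (i + 1)) =
      ∑ k ∈ Finset.range (n + 1),
        (-t) ^ k * (n.choose k * catalan k) * (1 + t) ^ (2 * n - 2 * k) := by
  have hleft : ((C t * X + 1) ^ n * ((X + C t) ^ n * (1 + X)) : R[X]).coeff n =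
      ∑ i ∈ Finset.range (n + 1),
        (n.choose i : R) * t ^ i * (n.choose i * t ^ i + n.choose (i + 1) * t ^ (i + 1)) := by
    rw [add_pow, Finset.sum_mul, finsetSum_coeff]
    refine Finset.sum_congr rfl fun i hi => ?_
    have hi' : i ≤ n := Nat.lt_succ_iff.mp (Finset.mem_range.mp hi)
    rw [← coeff_X_add_C_pow_mul_one_add_X t hi']
    trans (C ((n.choose i : R) * t ^ i) * (((X + C t) ^ n * (1 + X)) * X ^ i) : R[X]).coeff n
    · congr 1
      simp only [C_mul, C_pow, map_natCast, one_pow]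
      ring
    · rw [coeff_C_mul, coeff_mul_X_pow', if_pos hi']
  have hright : ((C t * X + 1) ^ n * ((X + C t) ^ n * (1 + X)) : R[X]).coeff n =
      ∑ k ∈ Finset.range (n + 1),
        (-t) ^ k * (n.choose k * catalan k) * (1 + t) ^ (2 * n - 2 * k) := by
    have h : ((C t * X + 1) * (X + C t) : R[X]) = C t * (1 - X) ^ 2 + C ((1 + t) ^ 2) * X := by
      simp only [C_add, C_1, C_pow]
      ring
    rw [← mul_assoc, ← mul_pow, h, add_pow, Finset.sum_mul, finsetSum_coeff]
    refine Finset.sum_congr rfl fun k hk => ?_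
    have hk' : k ≤ n := Nat.lt_succ_iff.mp (Finset.mem_range.mp hk)
    trans (C (t ^ k * n.choose k * (1 + t) ^ (2 * n - 2 * k)) *
      (((1 - X) ^ (2 * k) * (1 + X)) * X ^ (n - k)) : R[X]).coeff n
    · congr 1
      rw [← Nat.mul_sub, pow_mul (1 + t) 2 (n - k)]
      simp only [C_mul, C_pow, map_natCast, mul_pow, ← pow_mul]
      ring
    · rw [coeff_C_mul, coeff_mul_X_pow', if_pos (Nat.sub_le n k), Nat.sub_sub_self hk',
        coeff_one_sub_X_pow_mul_one_add_X, neg_pow t]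
      ring
  rw [← hleft, hright]

theorem cnar_two_mul_add_one (n : ℕ) :
    cnar (2 * n + 1) = ∑ i ∈ Finset.range (n + 1),
      (n.choose i : ℤ[X]) * X ^ i *
        ((n.choose i : ℤ[X]) * X ^ i + (n.choose (i + 1) : ℤ[X]) * X ^ (i + 1)) := by
  rw [cnar, if_neg (by omega), show 2 * n + 1 + 1 = 2 * (n + 1) by ring,
    Finset.sum_range_two_mul]
  refine Finset.sum_congr rfl fun i _ => ?_
  rw [show (2 * n + 1 - 1) / 2 = n by omega, show (2 * n + 1) / 2 = n by omega,
    show 2 * i / 2 = i by omega, show (2 * i + 1) / 2 = i by omega,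
    show (2 * i + 1 + 1) / 2 = i + 1 by omega]
  simp only [Nat.cast_mul, C_mul, map_natCast]
  ring

theorem cnar_two_mul_add_two (n : ℕ) : cnar (2 * n + 2) = cnar (2 * n + 1) * (1 + X) := by
  have hlast : cnar (2 * n + 2) = ∑ i ∈ Finset.range (n + 1),
      ((n.choose i * (n + 1).choose i : ℤ[X]) * X ^ (2 * i) +
        (n.choose i * (n + 1).choose (i + 1) : ℤ[X]) * X ^ (2 * i + 1)) := by
    rw [cnar, if_neg (by omega), Finset.sum_range_succ, show 2 * n + 2 = 2 * (n + 1) by ring,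
      Finset.sum_range_two_mul, show (2 * (n + 1) - 1) / 2 = n by omega,
      show 2 * (n + 1) / 2 = n + 1 by omega, Nat.choose_succ_self, zero_mul, Nat.cast_zero, C_0,
      zero_mul, add_zero]
    refine Finset.sum_congr rfl fun i _ => ?_
    rw [show 2 * i / 2 = i by omega, show (2 * i + 1) / 2 = i by omega,
      show (2 * i + 1 + 1) / 2 = i + 1 by omega]
    simp only [Nat.cast_mul, C_mul, map_natCast]
  have hshift : ∑ i ∈ Finset.range (n + 1),
        (n.choose i * (n + 1).choose i : ℤ[X]) * X ^ (2 * i) =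
      ∑ i ∈ Finset.range (n + 1), ((n.choose i * n.choose i : ℤ[X]) * X ^ (2 * i) +
        (n.choose i * n.choose (i + 1) : ℤ[X]) * X ^ (2 * i + 2)) := by
    rw [Finset.sum_add_distrib, Finset.sum_range_succ', Finset.sum_range_succ' (fun i =>
      (n.choose i * n.choose i : ℤ[X]) * X ^ (2 * i)), Finset.sum_range_succ (fun i =>
      (n.choose i * n.choose (i + 1) : ℤ[X]) * X ^ (2 * i + 2)), Nat.choose_succ_self]
    simp only [Nat.choose_succ_succ', Nat.cast_add, mul_add, add_mul, Finset.sum_add_distrib,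
      Nat.choose_zero_right]
    simp only [mul_comm (n.choose (_ + 1) : ℤ[X]) (n.choose _ : ℤ[X])]
    push_cast
    ring
  rw [hlast, cnar_two_mul_add_one, Finset.sum_add_distrib, hshift, ← Finset.sum_add_distrib,
    Finset.sum_mul]
  refine Finset.sum_congr rfl fun i _ => ?_
  rw [Nat.choose_succ_succ']
  push_cast
  ring

/-- For every `n ≥ 0`, in `ℤ[t]`:
`c_{2n+1}(t) = ∑_{k=0}^n (-t)^k binom(n,k) C_k (1+t)^{2n-2k}` and
`c_{2n+2}(t) = ∑_{k=0}^n (-t)^k binom(n,k) C_k (1+t)^{2n-2k+1}`,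
where `C_k` is the `k`-th Catalan number. -/
theorem cnar_odd_even_formulas (n : ℕ) :
    cnar (2 * n + 1) =
        (∑ k ∈ Finset.range (n + 1),
          (-Polynomial.X) ^ k * Polynomial.C ((n.choose k * catalan k : ℕ) : ℤ)
            * (1 + Polynomial.X) ^ (2 * n - 2 * k)) ∧
      cnar (2 * n + 2) =
        ∑ k ∈ Finset.range (n + 1),
          (-Polynomial.X) ^ k * Polynomial.C ((n.choose k * catalan k : ℕ) : ℤ)
            * (1 + Polynomial.X) ^ (2 * n - 2 * k + 1) := by
  have hodd : cnar (2 * n + 1) = ∑ k ∈ Finset.range (n + 1),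
      (-Polynomial.X) ^ k * Polynomial.C ((n.choose k * catalan k : ℕ) : ℤ)
        * (1 + Polynomial.X) ^ (2 * n - 2 * k) := by
    rw [cnar_two_mul_add_one, sum_choose_mul_eq_sum_choose_mul_catalan]
    simp only [Nat.cast_mul, C_mul, map_natCast]
  refine ⟨hodd, ?_⟩
  rw [cnar_two_mul_add_two, hodd, Finset.sum_mul]
  simp only [pow_succ, mul_assoc]
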